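/- arXiv:1711.04720 — 3 statements merged into one kernel-verified Lean document; each statement's English description precedes it below -/
import Mathlib

section
/- Let G be a finite nonempty simple graph with no isolated vertices. Then the vertex set V(G) is the union of ⌊|V(G)|/2⌋ sets, each of which has cardinality 2 or 3 and induces a connected subgraph of G. -/
namespace SimpleGraph

variable {V : Type*}

/-- A finite graph without isolated vertices has a spanning subgraph without isolated vertices
in which every edge has an end of degree one. -/
theorem exists_le_forall_adj_leaf [Finite V] (G : SimpleGraph V)
    (hiso : ∀ v, ∃ w, G.Adj v w) :
    ∃ H ≤ G, (∀ v, ∃ w, H.Adj v w) ∧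
      ∀ u v, H.Adj u v → (∀ x, H.Adj u x → x = v) ∨ (∀ x, H.Adj v x → x = u) := by
  classical
  obtain ⟨H, hHG, hH⟩ := (Set.toFinite {H : SimpleGraph V | ∀ v, ∃ w, H.Adj v w}).exists_le_minimal
    (a := G) hiso
  refine ⟨H, hHG, hH.prop, fun u v huv ↦ ?_⟩
  by_contra! hcon
  obtain ⟨⟨x, hux, hxv⟩, y, hvy, hyu⟩ := hcon
  have hdel : ∀ z, ∃ w, (H.deleteEdges {s(u, v)}).Adj z w := by
    intro z
    by_cases hzu : z = u
    · exact ⟨x, by simp only [deleteEdges_adj, Set.mem_singleton_iff, Sym2.eq_iff]; grind⟩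
    by_cases hzv : z = v
    · exact ⟨y, by simp only [deleteEdges_adj, Set.mem_singleton_iff, Sym2.eq_iff]; grind⟩
    obtain ⟨w, hw⟩ := hH.prop z
    exact ⟨w, by simp only [deleteEdges_adj, Set.mem_singleton_iff, Sym2.eq_iff]; grind⟩
  have := hH.le_of_le hdel (deleteEdges_le _) huv
  simp [deleteEdges_adj] at this

theorem induce_triple_connected_of_adj {G : SimpleGraph V} {u v w : V} (huv : G.Adj u v)
    (hvw : G.Adj v w) : (G.induce {u, v, w}).Connected := by
  have h := induce_union_connected (induce_pair_connected_of_adj huv).preconnected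
    (induce_pair_connected_of_adj hvw).preconnected ⟨v, by simp⟩
  have hs : ({u, v} ∪ {v, w} : Set V) = {u, v, w} := by ext; simp; tauto
  rwa [hs] at h

variable [DecidableEq V]

/-- In a graph whose edges all have an end of degree one, a nonempty vertex set without isolated
vertices contains at least two vertices that lie in a common connected pair or triple and whose
removal leaves no isolated vertices. -/
theorem exists_removable_of_forall_adj_leaf {H : SimpleGraph V}
    (hH : ∀ u v, H.Adj u v → (∀ x, H.Adj u x → x = v) ∨ (∀ x, H.Adj v x → x = u))
    {S : Finset V} (hS : ∀ v ∈ S, ∃ w ∈ S, H.Adj v w) (hne : S.Nonempty) :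
    ∃ R ⊆ S, ∃ T : Finset V, R ⊆ T ∧ 2 ≤ R.card ∧ (T.card = 2 ∨ T.card = 3) ∧
      (H.induce (T : Set V)).Connected ∧ ∀ v ∈ S \ R, ∃ w ∈ S \ R, H.Adj v w := by
  have hleaf : ∃ v ∈ S, ∃ w ∈ S, H.Adj v w ∧ ∀ x, H.Adj v x → x = w := by
    obtain ⟨v, hv⟩ := hne
    obtain ⟨w, hw, hvw⟩ := hS v hv
    rcases hH v w hvw with h | h
    · exact ⟨v, hv, w, hw, hvw, h⟩
    · exact ⟨w, hw, v, hv, hvw.symm, h⟩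
  obtain ⟨v, hv, w, hw, hvw, hvl⟩ := hleaf
  have hvw' := hvw.ne
  by_cases hx : ∃ x ∈ S, H.Adj w x ∧ x ≠ v
  · obtain ⟨x, hxS, hwx, hxv⟩ := hx
    have hwx' := hwx.ne
    have hxl : ∀ y, H.Adj x y → y = w :=
      (hH x w hwx.symm).resolve_right fun h ↦ hxv (h v hvw.symm).symm
    have hcard : ({v, w, x} : Finset V).card = 3 := Finset.card_eq_three.2
      ⟨v, w, x, hvw', hxv.symm, hwx', rfl⟩
    have hconn : (H.induce (({v, w, x} : Finset V) : Set V)).Connected := by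
      rw [Finset.coe_insert, Finset.coe_pair]
      exact induce_triple_connected_of_adj hvw hwx
    by_cases hy : ∃ y ∈ S, H.Adj w y ∧ y ≠ v ∧ y ≠ x
    · obtain ⟨y, hyS, hwy, hyv, hyx⟩ := hy
      refine ⟨{v, x}, by grind, {v, w, x}, by grind, (Finset.card_pair hxv.symm).ge,
        .inr hcard, hconn, fun z hz ↦ ?_⟩
      by_cases hzw : z = w
      · exact ⟨y, by grind, hzw ▸ hwy⟩
      · obtain ⟨t, ht, hzt⟩ := hS z (by grind)
        have := hzt.symm
        exact ⟨t, by grind, hzt⟩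
    · refine ⟨{v, w, x}, by grind, {v, w, x}, by grind, by omega, .inr hcard, hconn,
        fun z hz ↦ ?_⟩
      obtain ⟨t, ht, hzt⟩ := hS z (by grind)
      have := hzt.symm
      exact ⟨t, by grind, hzt⟩
  · refine ⟨{v, w}, by grind, {v, w}, by grind, (Finset.card_pair hvw').ge,
      .inl (Finset.card_pair hvw'), Finset.coe_pair (a := v) (b := w) ▸ induce_pair_connected_of_adj hvw,
      fun z hz ↦ ?_⟩
    obtain ⟨t, ht, hzt⟩ := hS z (by grind)
    have := hzt.symm
    exact ⟨t, by grind, hzt⟩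

theorem exists_connected_cover_of_forall_adj_leaf {H : SimpleGraph V}
    (hH : ∀ u v, H.Adj u v → (∀ x, H.Adj u x → x = v) ∨ (∀ x, H.Adj v x → x = u))
    (S : Finset V) (hS : ∀ v ∈ S, ∃ w ∈ S, H.Adj v w) :
    ∃ F : Finset (Finset V), 2 * F.card ≤ S.card ∧
      (∀ T ∈ F, (T.card = 2 ∨ T.card = 3) ∧ (H.induce (T : Set V)).Connected) ∧
      ∀ v ∈ S, ∃ T ∈ F, v ∈ T := by
  induction S using Finset.strongInduction with
  | H S ih =>
    rcases S.eq_empty_or_nonempty with rfl | hne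
    · exact ⟨∅, by simp⟩
    obtain ⟨R, hRS, T, hRT, hR, hT, hconn, hrest⟩ :=
      exists_removable_of_forall_adj_leaf hH hS hne
    have hRne : R.Nonempty := Finset.card_pos.1 (by omega)
    obtain ⟨F, hF, hgood, hcov⟩ := ih (S \ R) (Finset.sdiff_ssubset hRS hRne) hrest
    refine ⟨insert T F, ?_, ?_, fun v hv ↦ ?_⟩
    · have := Finset.card_insert_le T F
      have := Finset.card_sdiff_add_card_eq_card hRS
      omega
    · simpa using ⟨⟨hT, hconn⟩, hgood⟩
    · by_cases hvR : v ∈ R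
      · exact ⟨T, by simp, hRT hvR⟩
      · obtain ⟨U, hU, hvU⟩ := hcov v (by simp [hv, hvR])
        exact ⟨U, by simp [hU], hvU⟩

end SimpleGraph

theorem stmt2 {V : Type*} [Fintype V] [DecidableEq V] [Nonempty V]
    (G : SimpleGraph V) (hiso : ∀ v : V, ∃ w, G.Adj v w) :
    ∃ f : Fin (Fintype.card V / 2) → Finset V,
      (∀ i, (f i).card = 2 ∨ (f i).card = 3) ∧
      (∀ i, (G.induce ((f i : Finset V) : Set V)).Connected) ∧
      (∀ v : V, ∃ i, v ∈ f i) := by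
  obtain ⟨H, hHG, hHiso, hH⟩ := G.exists_le_forall_adj_leaf hiso
  obtain ⟨F, hF, hgood, hcov⟩ :=
    SimpleGraph.exists_connected_cover_of_forall_adj_leaf hH Finset.univ (by simpa using hHiso)
  have hne : Nonempty F := by
    obtain ⟨T, hT, -⟩ := hcov (Classical.arbitrary V) (Finset.mem_univ _)
    exact ⟨⟨T, hT⟩⟩
  have hcard : Fintype.card F ≤ Fintype.card (Fin (Fintype.card V / 2)) := by
    rw [Finset.card_univ] at hF
    simp only [Fintype.card_coe, Fintype.card_fin]
    omega
  obtain ⟨e⟩ := Function.Embedding.nonempty_of_card_le hcard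
  refine ⟨fun i ↦ (Function.invFun e i).1, fun i ↦ (hgood _ (Function.invFun e i).2).1,
    fun i ↦ (hgood _ (Function.invFun e i).2).2.mono fun _ _ h ↦ hHG h, fun v ↦ ?_⟩
  obtain ⟨T, hT, hvT⟩ := hcov v (Finset.mem_univ v)
  exact ⟨e ⟨T, hT⟩, by simpa only [Function.leftInverse_invFun e.injective _] using hvT⟩
end

section
/- Let Λ be a finite connected graph, β > 0, v ∈ Λ, and f: Λ → ℝ with Σ_j f(j) = 0. Then the expectation of exp(⟨m, f⟩) under the integer-valued discrete Gaussian free field on Λ at inverse temperature β normalized to m_v = 0 is at most exp((1/(2β))·⟨f, −Δ⁻¹f⟩), where Δ⁻¹ is the Moore–Penrose pseudoinverse of the graph Laplacian. -/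
open scoped ENNReal

/-- A product of nonnegative summable weights is summable over a finite power. -/
theorem summable_prod_of_summable {ι α : Type*} [Fintype ι] {w : α → ℝ}
    (hw : ∀ a, 0 ≤ w a) (hs : Summable w) :
    Summable fun d : ι → α => ∏ i, w (d i) := by
  classical
  refine summable_of_sum_le (c := ∏ _i : ι, ∑' a, w a)
    (fun d => Finset.prod_nonneg fun i _ => hw _) fun s => ?_
  have hsub : s ⊆ Fintype.piFinset fun i => s.image fun d => d i := fun d hd =>
    Fintype.mem_piFinset.2 fun i => Finset.mem_image_of_mem _ hd
  calc ∑ d ∈ s, ∏ i, w (d i)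
      ≤ ∑ d ∈ Fintype.piFinset fun i => s.image fun d => d i, ∏ i, w (d i) :=
        Finset.sum_le_sum_of_subset_of_nonneg hsub fun d _ _ =>
          Finset.prod_nonneg fun i _ => hw _
    _ = ∏ i, ∑ a ∈ s.image fun d => d i, w a := (Finset.prod_univ_sum _ _).symm
    _ ≤ ∏ _i : ι, ∑' a, w a :=
        Finset.prod_le_prod (fun i _ => Finset.sum_nonneg fun a _ => hw a)
          fun i _ => hs.sum_le_tsum _ fun a _ => hw a

theorem summable_exp_neg_mul_int_sq {c : ℝ} (hc : 0 < c) :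
    Summable fun k : ℤ => Real.exp (-c * (k : ℝ) ^ 2) := by
  have hnat : Summable fun n : ℕ => Real.exp (-c * (n : ℝ) ^ 2) := by
    refine Real.summable_exp_nat_mul_of_ge (neg_lt_zero.2 hc) fun n => ?_
    exact_mod_cast Nat.le_self_pow two_ne_zero n
  exact Summable.of_nat_of_neg (by simpa using hnat) (by simpa using hnat)

/-- Cauchy-Schwarz over the cosets of the subgroup of doubles. -/
theorem two_mul_tsum_add_sub_le {A : Type*} [AddCommGroup A]
    (hA : Function.Injective fun a : A => a + a) (F H : A → ℝ≥0∞) :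
    2 * ∑' m, ∑' n, F (m + n) * H (m - n) ≤
      ∑' m, ∑' n, F (m + n) * F (m - n) + ∑' m, ∑' n, H (m + n) * H (m - n) := by
  let D : AddSubgroup A := (AddMonoidHom.id A + AddMonoidHom.id A).range
  have hD : ∀ x : A, x + x ∈ D := fun x => ⟨x, rfl⟩
  let e : (A ⧸ D) × A ≃ A := Equiv.ofBijective (fun p => p.1.out + (p.2 + p.2)) <| by
    constructor
    · rintro ⟨c, x⟩ ⟨d, y⟩ h
      have h' : c.out + (x + x) = d.out + (y + y) := h
      have hcd : c = d := by
        have := congrArg (QuotientAddGroup.mk (s := D)) h'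
        rwa [QuotientAddGroup.mk_add_of_mem _ (hD x), QuotientAddGroup.mk_add_of_mem _ (hD y),
          QuotientAddGroup.out_eq', QuotientAddGroup.out_eq'] at this
      subst hcd
      rw [hA (add_left_cancel h')]
    · intro a
      have h : -(QuotientAddGroup.mk (s := D) a).out + a ∈ D :=
        QuotientAddGroup.eq.1 (QuotientAddGroup.out_eq' _)
      obtain ⟨x, hx⟩ := h
      refine ⟨(QuotientAddGroup.mk a, x), ?_⟩
      have hx' : x + x = -(QuotientAddGroup.mk (s := D) a).out + a := hx
      simp only [hx', add_neg_cancel_left]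
  have key : ∀ F H : A → ℝ≥0∞, ∑' m, ∑' n, F (m + n) * H (m - n) =
      ∑' c, (∑' x, F (e (c, x))) * ∑' x, H (e (c, x)) := by
    intro F H
    calc ∑' m, ∑' n, F (m + n) * H (m - n)
        = ∑' n, ∑' m, F (m + n) * H (m - n) := ENNReal.tsum_comm
      _ = ∑' n, ∑' k, F (k + (n + n)) * H k := by
          refine tsum_congr fun n => ?_
          rw [← (Equiv.addRight n).tsum_eq]
          simp [add_assoc]
      _ = ∑' k, ∑' n, F (k + (n + n)) * H k := ENNReal.tsum_comm
      _ = ∑' p : (A ⧸ D) × A, ∑' n, F (e p + (n + n)) * H (e p) :=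
          (e.tsum_eq fun k => ∑' n, F (k + (n + n)) * H k).symm
      _ = ∑' c, ∑' x, ∑' n, F (e (c, x) + (n + n)) * H (e (c, x)) :=
          ENNReal.tsum_prod (f := fun c x => ∑' n, F (e (c, x) + (n + n)) * H (e (c, x)))
      _ = ∑' c, (∑' x, F (e (c, x))) * ∑' x, H (e (c, x)) := by
          refine tsum_congr fun c => ?_
          rw [← ENNReal.tsum_mul_left]
          refine tsum_congr fun x => ?_
          rw [ENNReal.tsum_mul_right, ← (Equiv.addLeft x).tsum_eq fun y => F (e (c, y))]
          congr 1
          refine tsum_congr fun n => congrArg F ?_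
          change c.out + (x + x) + (n + n) = c.out + ((x + n) + (x + n))
          abel
  have amgm : ∀ a b : ℝ≥0∞, 2 * (a * b) ≤ a * a + b * b := by
    intro a b
    rcases eq_or_ne a ∞ with rfl | ha
    · simp
    rcases eq_or_ne b ∞ with rfl | hb
    · simp
    lift a to NNReal using ha
    lift b to NNReal using hb
    norm_cast
    rw [← NNReal.coe_le_coe]
    push_cast
    nlinarith [sq_nonneg ((a : ℝ) - b)]
  rw [key, key, key, ← ENNReal.tsum_mul_left, ← ENNReal.tsum_add]
  exact ENNReal.tsum_le_tsum fun c => amgm _ _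

section Theta

variable {A W : Type*} [AddCommGroup A] [AddCommGroup W]

/-- The Gaussian sum of `q` over the image of `φ`, centred at `g`. -/
noncomputable def gaussianSum (φ : A →+ W) (q : W → ℝ) (g : W) : ℝ≥0∞ :=
  ∑' m, ENNReal.ofReal (Real.exp (-q (φ m - g)))

theorem two_mul_gaussianSum_sq_le (hA : Function.Injective fun a : A => a + a)
    (φ : A →+ W) (q : W → ℝ)
    (hq : ∀ x y, q (x + y) + q (x - y) = 2 * q x + 2 * q y) (g : W) :
    2 * (gaussianSum φ q g * gaussianSum φ q g) ≤
      gaussianSum φ q (g + g) * gaussianSum φ q 0 + gaussianSum φ q 0 * gaussianSum φ q 0 := by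
  have prodsum : ∀ a b c d : W, (∀ x y : W, q (x - a) + q (y - b) =
        q (x + y - c) / 2 + q (x - y - d) / 2) →
      gaussianSum φ q a * gaussianSum φ q b =
        ∑' m, ∑' n, ENNReal.ofReal (Real.exp (-(q (φ (m + n) - c) / 2))) *
          ENNReal.ofReal (Real.exp (-(q (φ (m - n) - d) / 2))) := by
    intro a b c d h
    unfold gaussianSum
    rw [← ENNReal.tsum_mul_right]
    refine tsum_congr fun m => ?_
    rw [← ENNReal.tsum_mul_left]
    refine tsum_congr fun n => ?_
    rw [← ENNReal.ofReal_mul (Real.exp_pos _).le, ← ENNReal.ofReal_mul (Real.exp_pos _).le,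
      ← Real.exp_add, ← Real.exp_add, map_add, map_sub]
    congr 2
    linarith [h (φ m) (φ n)]
  have half : ∀ x y u w : W, u = x + y → w = x - y → q x + q y = q u / 2 + q w / 2 := by
    rintro x y _ _ rfl rfl
    linarith [hq x y]
  rw [prodsum g g (g + g) 0 fun x y => half _ _ _ _ (by abel) (by abel),
    prodsum (g + g) 0 (g + g) (g + g) fun x y => half _ _ _ _ (by abel) (by abel),
    prodsum 0 0 0 0 fun x y => half _ _ _ _ (by abel) (by abel)]
  exact two_mul_tsum_add_sub_le hA
    (fun a => ENNReal.ofReal (Real.exp (-(q (φ a - (g + g)) / 2))))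
    (fun a => ENNReal.ofReal (Real.exp (-(q (φ a - 0) / 2))))

/-- A lattice Gaussian sum is largest when centred at a lattice point. -/
theorem gaussianSum_le_gaussianSum_zero (hA : Function.Injective fun a : A => a + a)
    (φ : A →+ W) (q : W → ℝ) (hq0 : ∀ x, 0 ≤ q x)
    (hq : ∀ x y, q (x + y) + q (x - y) = 2 * q x + 2 * q y)
    (hs : Summable fun m => Real.exp (-(q (φ m) / 2)))
    {C : ℝ} (hC : ∀ h, ∃ a, q (h - φ a) ≤ C) (g : W) :
    gaussianSum φ q g ≤ gaussianSum φ q 0 := by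
  have periodic : ∀ h a, gaussianSum φ q (h - φ a) = gaussianSum φ q h := by
    intro h a
    unfold gaussianSum
    rw [← (Equiv.addRight a).tsum_eq fun m => ENNReal.ofReal (Real.exp (-q (φ m - h)))]
    refine tsum_congr fun m => ?_
    simp only [Equiv.coe_addRight, map_add]
    congr 4
    abel
  set K : ℝ≥0∞ := ENNReal.ofReal (Real.exp C) *
    ∑' m, ENNReal.ofReal (Real.exp (-(q (φ m) / 2))) with hK
  have hKtop : K ≠ ∞ := ENNReal.mul_ne_top ENNReal.ofReal_ne_top hs.tsum_ofReal_ne_top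
  have bound : ∀ h, gaussianSum φ q h ≤ K := by
    intro h
    obtain ⟨a, ha⟩ := hC h
    rw [← periodic h a, hK, ← ENNReal.tsum_mul_left]
    refine ENNReal.tsum_le_tsum fun m => ?_
    rw [← ENNReal.ofReal_mul (Real.exp_pos _).le, ← Real.exp_add]
    refine ENNReal.ofReal_le_ofReal (Real.exp_le_exp.2 ?_)
    have := hq (φ m - (h - φ a)) (h - φ a)
    rw [sub_add_cancel] at this
    linarith [hq0 (φ m - (h - φ a) - (h - φ a))]
  set T : W → ℝ := fun h => (gaussianSum φ q h).toReal with hT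
  have hfin : ∀ h, gaussianSum φ q h ≠ ∞ := fun h => ne_top_of_le_ne_top hKtop (bound h)
  have hTsq : ∀ h, 2 * (T h * T h) ≤ T (h + h) * T 0 + T 0 * T 0 := by
    intro h
    have := two_mul_gaussianSum_sq_le hA φ q hq h
    have := ENNReal.toReal_mono (by finiteness [hfin 0, hfin (h + h)]) this
    rw [ENNReal.toReal_add (ENNReal.mul_ne_top (hfin _) (hfin _))
      (ENNReal.mul_ne_top (hfin _) (hfin _))] at this
    simpa [ENNReal.toReal_mul] using this
  have hbdd : BddAbove (Set.range T) :=
    ⟨K.toReal, by rintro _ ⟨h, rfl⟩; exact ENNReal.toReal_mono hKtop (bound h)⟩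
  have h0 : 0 ≤ T 0 := ENNReal.toReal_nonneg
  have hle : ∀ h, T h ≤ ⨆ h, T h := le_ciSup hbdd
  set M : ℝ := ⨆ h, T h with hM
  have hMsup : M ≤ T 0 := by
    by_contra! hlt
    obtain ⟨h, hh⟩ := exists_lt_of_lt_ciSup
      (show max (T 0) ((M + T 0) / 2) < ⨆ h, T h from max_lt hlt (by linarith))
    have h1 : T 0 < T h := (le_max_left _ _).trans_lt hh
    have h2 : (M + T 0) / 2 < T h := (le_max_right _ _).trans_lt hh
    nlinarith [hTsq h, mul_le_mul_of_nonneg_right (hle (h + h)) h0]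
  exact (ENNReal.toReal_le_toReal (hfin g) (hfin 0)).1 ((hle g).trans hMsup)

end Theta

section Graph

variable {V : Type*} [Fintype V] {G : SimpleGraph V} [DecidableRel G.Adj]

/-- Summation by parts for the graph Laplacian. -/
theorem sum_neighbor_mul_sub (G : SimpleGraph V) [DecidableRel G.Adj] (x y : V → ℝ) :
    ∑ j, ∑ ℓ ∈ G.neighborFinset j, (x j - x ℓ) * (y j - y ℓ) =
      2 * ∑ j, x j * ∑ ℓ ∈ G.neighborFinset j, (y j - y ℓ) := by
  have swap : ∑ j, ∑ ℓ ∈ G.neighborFinset j, x ℓ * (y j - y ℓ) =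
      ∑ j, ∑ ℓ ∈ G.neighborFinset j, x j * (y ℓ - y j) :=
    Finset.sum_comm' fun j ℓ => by simp [G.adj_comm]
  calc ∑ j, ∑ ℓ ∈ G.neighborFinset j, (x j - x ℓ) * (y j - y ℓ)
      = ∑ j, ∑ ℓ ∈ G.neighborFinset j, x j * (y j - y ℓ) -
          ∑ j, ∑ ℓ ∈ G.neighborFinset j, x ℓ * (y j - y ℓ) := by
        simp only [← Finset.sum_sub_distrib, ← sub_mul]
    _ = _ := by
        rw [swap]
        simp only [Finset.mul_sum, ← Finset.sum_sub_distrib]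
        exact Finset.sum_congr rfl fun j _ => Finset.sum_congr rfl fun ℓ _ => by ring

/-- Gaussian weights of the gradient are summable over integer fields pinned at a vertex. -/
theorem summable_exp_neg_mul_gradient_sq (hconn : G.Connected) {c : ℝ} (hc : 0 < c) (v : V) :
    Summable fun m : {m : V → ℤ // m v = 0} =>
      Real.exp (-c * ∑ j, ∑ ℓ ∈ G.neighborFinset j, ((m.1 j : ℝ) - (m.1 ℓ : ℝ)) ^ 2) := by
  let grad : {m : V → ℤ // m v = 0} → (Σ j, G.neighborFinset j) → ℤ :=
    fun m p => m.1 p.1 - m.1 p.2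
  have hinj : Function.Injective grad := by
    intro m n hmn
    have hadj : ∀ {j ℓ}, G.Adj j ℓ → m.1 j - n.1 j = m.1 ℓ - n.1 ℓ := by
      intro j ℓ h
      have := congrFun hmn ⟨j, ℓ, by simpa using h⟩
      simp only [grad] at this
      omega
    have hwalk : ∀ {j ℓ}, G.Walk j ℓ → m.1 j - n.1 j = m.1 ℓ - n.1 ℓ := by
      intro j ℓ p
      induction p with
      | nil => rfl
      | cons h _ ih => exact (hadj h).trans ih
    ext j
    obtain ⟨p⟩ := hconn.preconnected j v
    have := hwalk p
    rw [m.2, n.2] at this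
    omega
  have := (summable_prod_of_summable (ι := Σ j, G.neighborFinset j)
    (fun k => (Real.exp_pos _).le) (summable_exp_neg_mul_int_sq hc)).comp_injective hinj
  refine this.congr fun m => ?_
  simp only [Function.comp_apply, ← Real.exp_sum, ← Finset.mul_sum, grad, Fintype.sum_sigma]
  congr 2
  refine Finset.sum_congr rfl fun j _ => ?_
  push_cast
  exact Finset.sum_coe_sort (G.neighborFinset j) fun ℓ => ((m.1 j : ℝ) - (m.1 ℓ : ℝ)) ^ 2

end Graph

theorem stmt7 {V : Type*} [Fintype V] [DecidableEq V]
    (G : SimpleGraph V) [DecidableRel G.Adj] (hconn : G.Connected)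
    (β : ℝ) (hβ : 0 < β) (v : V)
    (Δ : (V → ℝ) → (V → ℝ))
    (hΔ : ∀ f j, Δ f j = ∑ ℓ ∈ G.neighborFinset j, (f ℓ - f j))
    (Δinv : (V → ℝ) →ₗ[ℝ] (V → ℝ))
    (hinv1 : ∀ f : V → ℝ, ∑ j, f j = 0 → Δ (Δinv f) = f ∧ Δinv (Δ f) = f)
    (hinv2 : ∀ c : ℝ, Δinv (fun _ => c) = 0)
    (f : V → ℝ) (hf : ∑ j, f j = 0) :
    (∑' m : {m : V → ℤ // m v = 0}, Real.exp (∑ j, (m.1 j : ℝ) * f j) *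
        Real.exp (-(β/4) * ∑ j, ∑ ℓ ∈ G.neighborFinset j, ((m.1 j : ℝ) - (m.1 ℓ : ℝ)) ^ 2)) ≤
      Real.exp ((1/(2*β)) * ∑ j, f j * (-(Δinv f j))) *
        ∑' m : {m : V → ℤ // m v = 0},
          Real.exp (-(β/4) * ∑ j, ∑ ℓ ∈ G.neighborFinset j, ((m.1 j : ℝ) - (m.1 ℓ : ℝ)) ^ 2) := by
  set q : (V → ℝ) → ℝ := fun x =>
    (β/4) * ∑ j, ∑ ℓ ∈ G.neighborFinset j, (x j - x ℓ) ^ 2 with hqdef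
  let A : AddSubgroup (V → ℤ) := (Pi.evalAddMonoidHom (fun _ : V => ℤ) v).ker
  let φ : A →+ (V → ℝ) := ((Int.castAddHom ℝ).compLeft V).comp A.subtype
  have hA : Function.Injective fun a : A => a + a := by
    intro a b hab
    ext j
    have : a.1 j + a.1 j = b.1 j + b.1 j := congrFun (congrArg Subtype.val hab) j
    omega
  have hq0 : ∀ x, 0 ≤ q x := fun x => by positivity
  have hq : ∀ x y, q (x + y) + q (x - y) = 2 * q x + 2 * q y := by
    intro x y
    simp only [hqdef, Finset.mul_sum, ← Finset.sum_add_distrib, Pi.add_apply, Pi.sub_apply]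
    exact Finset.sum_congr rfl fun j _ => Finset.sum_congr rfl fun ℓ _ => by ring
  have hs : Summable fun m : A => Real.exp (-(q (φ m) / 2)) := by
    refine (summable_exp_neg_mul_gradient_sq hconn (c := β / 8) (by positivity) v).congr
      fun m => ?_
    congr 1
    change _ = -((β / 4 * ∑ j, ∑ ℓ ∈ G.neighborFinset j, ((m.1 j : ℝ) - (m.1 ℓ : ℝ)) ^ 2) / 2)
    ring
  have hs' : Summable fun m : A => Real.exp (-q (φ m)) := by
    refine hs.of_nonneg_of_le (fun m => (Real.exp_pos _).le) fun m => ?_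
    exact Real.exp_le_exp.2 (by linarith [hq0 (φ m)])
  have hC : ∀ h, ∃ a, q (h - φ a) ≤ (β/4) * ∑ j, ∑ _ℓ ∈ G.neighborFinset j, (1 : ℝ) := by
    intro h
    refine ⟨⟨fun j => ⌊h j⌋ - ⌊h v⌋, sub_self _⟩, ?_⟩
    refine mul_le_mul_of_nonneg_left (Finset.sum_le_sum fun j _ => Finset.sum_le_sum fun ℓ _ => ?_)
      (by positivity)
    change ((h j - ((⌊h j⌋ - ⌊h v⌋ : ℤ) : ℝ)) - (h ℓ - ((⌊h ℓ⌋ - ⌊h v⌋ : ℤ) : ℝ))) ^ 2 ≤ 1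
    push_cast
    rw [sq_le_one_iff_abs_le_one, abs_le]
    constructor <;>
    linarith [Int.floor_le (h j), Int.lt_floor_add_one (h j), Int.floor_le (h ℓ),
      Int.lt_floor_add_one (h ℓ)]
  set g : V → ℝ := fun j => -(Δinv f j) / β with hg
  have hlap : ∀ j, ∑ ℓ ∈ G.neighborFinset j, (g j - g ℓ) = f j / β := by
    intro j
    have := congrFun (hinv1 f hf).1 j
    rw [hΔ] at this
    rw [← this, Finset.sum_div]
    exact Finset.sum_congr rfl fun ℓ _ => by simp only [hg]; ring
  have square : ∀ x : V → ℝ, ∑ j, x j * f j + -q x =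
      (1/(2*β)) * ∑ j, f j * (-(Δinv f j)) + -q (x - g) := by
    intro x
    have expand : q (x - g) = q x - (β/2) * ∑ j, ∑ ℓ ∈ G.neighborFinset j,
        (x j - x ℓ) * (g j - g ℓ) + (β/4) * ∑ j, ∑ ℓ ∈ G.neighborFinset j,
        (g j - g ℓ) * (g j - g ℓ) := by
      simp only [hqdef, Finset.mul_sum, ← Finset.sum_add_distrib, ← Finset.sum_sub_distrib,
        Pi.sub_apply]
      exact Finset.sum_congr rfl fun j _ => Finset.sum_congr rfl fun ℓ _ => by ring
    rw [expand, sum_neighbor_mul_sub, sum_neighbor_mul_sub]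
    simp only [hlap]
    have h1 : ∑ j, x j * (f j / β) = (∑ j, x j * f j) / β := by
      rw [Finset.sum_div]
      exact Finset.sum_congr rfl fun j _ => by ring
    have h2 : ∑ j, g j * (f j / β) = (∑ j, f j * (-(Δinv f j))) / β ^ 2 := by
      rw [Finset.sum_div]
      exact Finset.sum_congr rfl fun j _ => by simp only [hg]; field_simp
    rw [h1, h2]
    field_simp
    ring
  have main := gaussianSum_le_gaussianSum_zero hA φ q hq0 hq hs hC g
  have real : ∀ h, (gaussianSum φ q h).toReal = ∑' m, Real.exp (-q (φ m - h)) := by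
    intro h
    rw [gaussianSum, ENNReal.tsum_toReal_eq fun _ => ENNReal.ofReal_ne_top]
    exact tsum_congr fun m => ENNReal.toReal_ofReal (Real.exp_pos _).le
  have top : gaussianSum φ q 0 ≠ ∞ := by
    simpa only [gaussianSum, sub_zero] using hs'.tsum_ofReal_ne_top
  have hle := ENNReal.toReal_mono top main
  rw [real, real] at hle
  simp only [sub_zero] at hle
  have hweight : ∀ m : A, Real.exp (-(β/4) * ∑ j, ∑ ℓ ∈ G.neighborFinset j,
      ((m.1 j : ℝ) - (m.1 ℓ : ℝ)) ^ 2) = Real.exp (-q (φ m)) := by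
    intro m
    rw [neg_mul]
    rfl
  change ∑' m : A, Real.exp (∑ j, (m.1 j : ℝ) * f j) * Real.exp (-(β/4) *
      ∑ j, ∑ ℓ ∈ G.neighborFinset j, ((m.1 j : ℝ) - (m.1 ℓ : ℝ)) ^ 2) ≤ _ * ∑' m : A,
      Real.exp (-(β/4) * ∑ j, ∑ ℓ ∈ G.neighborFinset j, ((m.1 j : ℝ) - (m.1 ℓ : ℝ)) ^ 2)
  simp only [hweight]
  calc ∑' m : A, Real.exp (∑ j, (m.1 j : ℝ) * f j) * Real.exp (-q (φ m))
      = ∑' m : A, Real.exp ((1/(2*β)) * ∑ j, f j * (-(Δinv f j))) *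
          Real.exp (-q (φ m - g)) := by
        refine tsum_congr fun m => ?_
        rw [← Real.exp_add, ← Real.exp_add]
        exact congrArg Real.exp (square (φ m))
    _ = Real.exp ((1/(2*β)) * ∑ j, f j * (-(Δinv f j))) * ∑' m : A, Real.exp (-q (φ m - g)) :=
        tsum_mul_left
    _ ≤ _ := mul_le_mul_of_nonneg_left hle (Real.exp_pos _).le
end

section
/- Let Λ be a finite connected graph and ρ: Λ → ℤ a neutral density, i.e. ρ not identically zero and Σ_j ρ(j) = 0. Then for every σ: Λ → ℝ, the quantity ⟨σ, ρ⟩ can be written as Σ_{j∼ℓ} c_{jℓ}(σ_j − σ_ℓ), a sum over edges joining vertices within distance 2·d(ρ) of a fixed reference vertex of supp(ρ), with integer coefficients c_{jℓ} satisfying |c_{jℓ}| ≤ (1/2)·Σ_j |ρ(j)|. -/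
/-- Along a path, `σ u - σ v` telescopes into a sum over darts, each used at most once. -/
theorem SimpleGraph.Walk.IsPath.exists_telescoping {V : Type*} [Fintype V] [DecidableEq V]
    {G : SimpleGraph V} {u v : V} (p : G.Walk u v) (hp : p.IsPath) :
    ∃ c : V → V → ℤ,
      (∀ j ℓ, c j ℓ ≠ 0 → G.Adj j ℓ ∧ j ∈ p.support ∧ ℓ ∈ p.support) ∧
      (∀ j ℓ, |c j ℓ| ≤ 1) ∧
      ∀ σ : V → ℝ, σ u - σ v = ∑ j, ∑ ℓ, (c j ℓ : ℝ) * (σ j - σ ℓ) := by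
  induction p with
  | nil => exact ⟨0, by simp, by simp, by simp⟩
  | @cons u w v h p ih =>
    rw [SimpleGraph.Walk.cons_isPath_iff] at hp
    obtain ⟨c, hsupp, hbound, hsum⟩ := ih hp.1
    have hu : ∀ ℓ, c u ℓ = 0 := fun ℓ => by
      by_contra hne
      exact hp.2 (hsupp u ℓ hne).2.1
    refine ⟨fun j ℓ => c j ℓ + if j = u then (if ℓ = w then 1 else 0) else 0, ?_, ?_, ?_⟩
    · intro j ℓ hne
      by_cases hc : c j ℓ = 0
      · have hj : j = u := by by_contra hj; simp [hc, hj] at hne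
        have hℓ : ℓ = w := by by_contra hℓ; simp [hc, hℓ] at hne
        subst hj hℓ
        simp [h]
      · obtain ⟨hadj, hj, hℓ⟩ := hsupp j ℓ hc
        simp [hadj, hj, hℓ]
    · intro j ℓ
      by_cases hj : j = u
      · subst hj
        by_cases hℓ : ℓ = w <;> simp [hu, hℓ]
      · simpa [hj] using hbound j ℓ
    · intro σ
      simp only [Int.cast_add, add_mul, Finset.sum_add_distrib, ← hsum]
      simp

/-- A neutral density with positive part of mass `n`, supported in a set of diameter at most `d`,
is the divergence of an integer flow bounded by `n` near any reference vertex of that set. -/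
theorem SimpleGraph.Connected.exists_flow_of_sum_eq_zero {V : Type*} [Fintype V] [DecidableEq V]
    {G : SimpleGraph V} (hconn : G.Connected) {S : Set V} {d : ℕ}
    (hS : ∀ i ∈ S, ∀ j ∈ S, G.dist i j ≤ d) {j₀ : V} (hj₀ : j₀ ∈ S) (n : ℕ) (ρ : V → ℤ)
    (hsupp : ∀ i, ρ i ≠ 0 → i ∈ S) (hneutral : ∑ j, ρ j = 0) (hn : ∑ j, max (ρ j) 0 = n) :
    ∃ c : V → V → ℤ,
      (∀ j ℓ, c j ℓ ≠ 0 → G.Adj j ℓ ∧ G.dist j₀ j ≤ 2 * d ∧ G.dist j₀ ℓ ≤ 2 * d) ∧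
      (∀ j ℓ, |c j ℓ| ≤ n) ∧
      ∀ σ : V → ℝ, ∑ j, (ρ j : ℝ) * σ j = ∑ j, ∑ ℓ, (c j ℓ : ℝ) * (σ j - σ ℓ) := by
  induction n generalizing ρ with
  | zero =>
    have hmax := (Finset.sum_eq_zero_iff_of_nonneg fun i _ => le_max_right (ρ i) 0).1
      (by simpa using hn)
    have hle : ∀ i ∈ Finset.univ, ρ i ≤ 0 := fun i hi => by simpa using hmax i hi
    have hzero := (Finset.sum_eq_zero_iff_of_nonpos hle).1 hneutral
    exact ⟨0, by simp, by simp, by simp [fun i => hzero i (Finset.mem_univ i)]⟩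
  | succ n ih =>
    obtain ⟨a, ha⟩ : ∃ a, 0 < ρ a := by
      by_contra! hle
      simp only [max_eq_right (hle _), Finset.sum_const_zero] at hn
      omega
    obtain ⟨b, hb⟩ : ∃ b, ρ b < 0 := by
      by_contra! hge
      exact ha.ne' ((Finset.sum_eq_zero_iff_of_nonneg fun i _ => hge i).1 hneutral a
        (Finset.mem_univ a))
    have haS : a ∈ S := hsupp a ha.ne'
    have hbS : b ∈ S := hsupp b hb.ne
    have hab : a ≠ b := by rintro rfl; omega
    obtain ⟨p, hp, hlen⟩ := hconn.exists_path_of_dist a b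
    obtain ⟨cp, hcp, hcp_bound, hcp_sum⟩ := hp.exists_telescoping
    obtain ⟨c, hc, hc_bound, hc_sum⟩ := ih
      (fun i => ρ i - (if i = a then 1 else 0) + if i = b then 1 else 0)
      (by
        intro i hi
        by_cases hia : i = a
        · exact hia ▸ haS
        by_cases hib : i = b
        · exact hib ▸ hbS
        exact hsupp i (by simpa [hia, hib] using hi))
      (by simp [Finset.sum_add_distrib, hneutral])
      (by
        have hpos : ∀ i, max (ρ i - (if i = a then 1 else 0) + if i = b then 1 else 0) 0
            = max (ρ i) 0 - if i = a then 1 else 0 := by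
          intro i
          by_cases hia : i = a
          · subst hia
            simp only [if_true, if_neg hab]
            omega
          by_cases hib : i = b
          · subst hib
            simp only [if_true, if_neg hia]
            omega
          simp [hia, hib]
        simp [hpos, hn])
    have hnear : ∀ x ∈ p.support, G.dist j₀ x ≤ 2 * d := by
      intro x hx
      have htake : G.dist a x ≤ p.length :=
        (SimpleGraph.dist_le _).trans (p.length_takeUntil_le_length hx)
      have htri := hconn.dist_triangle (u := j₀) (v := a) (w := x)
      have := hS j₀ hj₀ a haS
      have := hS a haS b hbS
      omega
    refine ⟨fun j ℓ => c j ℓ + cp j ℓ, ?_, ?_, ?_⟩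
    · intro j ℓ hne
      by_cases hz : c j ℓ = 0
      · obtain ⟨hadj, hj, hℓ⟩ := hcp j ℓ (by simpa [hz] using hne)
        exact ⟨hadj, hnear j hj, hnear ℓ hℓ⟩
      · exact hc j ℓ hz
    · intro j ℓ
      push_cast
      exact (abs_add_le _ _).trans (add_le_add (hc_bound j ℓ) (hcp_bound j ℓ))
    · intro σ
      simp only [Int.cast_add, add_mul, Finset.sum_add_distrib, ← hcp_sum, ← hc_sum]
      simp [sub_mul, Finset.sum_sub_distrib]

theorem stmt8 {V : Type*} [Fintype V] [DecidableEq V]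
    (G : SimpleGraph V) [DecidableRel G.Adj] (hconn : G.Connected)
    (ρ : V → ℤ) (hρ : ρ ≠ 0) (hneutral : ∑ j, ρ j = 0)
    (d : ℕ)
    (hd1 : ∀ i j, ρ i ≠ 0 → ρ j ≠ 0 → G.dist i j ≤ d)
    (hd2 : ∃ i j, ρ i ≠ 0 ∧ ρ j ≠ 0 ∧ G.dist i j = d) :
    ∃ j₀, ρ j₀ ≠ 0 ∧ ∃ c : V → V → ℤ,
      (∀ j ℓ, c j ℓ ≠ 0 → G.Adj j ℓ ∧ G.dist j₀ j ≤ 2 * d ∧ G.dist j₀ ℓ ≤ 2 * d) ∧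
      (∀ j ℓ, |(c j ℓ : ℝ)| ≤ (1/2) * ∑ i, |(ρ i : ℝ)|) ∧
      ∀ σ : V → ℝ, ∑ j, (ρ j : ℝ) * σ j = ∑ j, ∑ ℓ, (c j ℓ : ℝ) * (σ j - σ ℓ) := by
  obtain ⟨j₀, -, hj₀, -⟩ := hd2
  obtain ⟨n, hn⟩ := Int.eq_ofNat_of_zero_le
    (Finset.sum_nonneg fun i (_ : i ∈ Finset.univ) => le_max_right (ρ i) 0)
  obtain ⟨c, hc, hbound, hsum⟩ := hconn.exists_flow_of_sum_eq_zero (S := {i | ρ i ≠ 0})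
    (fun i hi j hj => hd1 i j hi hj) hj₀ n ρ (fun _ hi => hi) hneutral hn
  refine ⟨j₀, hj₀, c, hc, fun j ℓ => ?_, hsum⟩
  have hnorm : ∑ i, |ρ i| = 2 * n := by
    have habs : ∀ i, |ρ i| = 2 * max (ρ i) 0 - ρ i := fun i => by
      rcases abs_cases (ρ i) with h | h <;> omega
    simp only [habs, Finset.sum_sub_distrib, ← Finset.mul_sum, hn, hneutral, sub_zero]
  have hnorm_real : ∑ i, |(ρ i : ℝ)| = 2 * n := by exact_mod_cast hnorm
  have hbound_real : |(c j ℓ : ℝ)| ≤ n := by exact_mod_cast hbound j ℓ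
  rw [hnorm_real]
  linarith
end
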